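/- Let N be a positive integer, let a be a 2N×2N complex matrix satisfying I·ā·I = a, let e and f be 2N×2N complex matrices such that the 4N×4N block matrix B = (e, f; f, e) is self-adjoint and symmetric (B* = Bᵗ = B), and set A = (0, a; a*, 0) as a 4N×4N block matrix. Let U range over the 4N×4N matrices diag(V, W) with V and W drawn independently from the normalized Haar measure on the compact symplectic group SP(2N). Then ⟨Tr(U*AUBU*AUB)⟩ = Tr(A²)·(Tr(e)² + Tr(I*·f·I·f)) / (4N²). -/

import Mathlib

open MeasureTheory Matrix

noncomputable instance (m n α : Type*) [MeasurableSpace α] : MeasurableSpace (Matrix m n α) :=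
  (inferInstance : MeasurableSpace (m → n → α))

/-- The `2N×2N` matrix `I` with `N×N` blocks `(0, -1; 1, 0)`. -/
def Imat (N : ℕ) : Matrix (Fin N ⊕ Fin N) (Fin N ⊕ Fin N) ℂ :=
  Matrix.fromBlocks 0 (-1) 1 0

theorem measurable_matrix_entry {m n : Type*} (i : m) (j : n) :
    Measurable fun V : Matrix m n ℂ => V i j :=
  (measurable_pi_apply j).comp (measurable_pi_apply (X := fun _ : m => n → ℂ) i)

theorem measurable_matrix_mul_left {n : Type*} [Fintype n] (S : Matrix n n ℂ) :
    Measurable fun V : Matrix n n ℂ => S * V := by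
  refine measurable_pi_iff.2 fun i => measurable_pi_iff.2 fun j => ?_
  simp only [Matrix.mul_apply]
  exact Finset.measurable_sum _ fun k _ => (measurable_matrix_entry k j).const_mul _

theorem integrable_entry_mul_star_entry {n : Type*} [Fintype n] [DecidableEq n]
    (μ : Measure (Matrix n n ℂ)) [IsProbabilityMeasure μ] (hμ : ∀ᵐ V ∂μ, Vᴴ * V = 1)
    (p q i k : n) : Integrable (fun V : Matrix n n ℂ => V p k * star (V q i)) μ := by
  refine Integrable.of_bound
    ((measurable_matrix_entry p k).mul
      (continuous_star.measurable.comp (measurable_matrix_entry q i))).aestronglyMeasurable 1 ?_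
  filter_upwards [hμ] with V hV
  have hV' : V ∈ Matrix.unitaryGroup n ℂ := Matrix.mem_unitaryGroup_iff'.2 hV
  rw [norm_mul, norm_star]
  exact mul_le_one₀ (entry_norm_bound_of_unitary hV' p k) (norm_nonneg _)
    (entry_norm_bound_of_unitary hV' q i)

theorem integral_comp_mul_left {n : Type*} [Fintype n] (μ : Measure (Matrix n n ℂ))
    {S : Matrix n n ℂ} (hS : μ.map (fun V => S * V) = μ) (p q i k : n) :
    ∫ V, V p k * star (V q i) ∂μ = ∫ V, (S * V) p k * star ((S * V) q i) ∂μ := by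
  conv_lhs => rw [← hS]
  exact integral_map (measurable_matrix_mul_left S).aemeasurable
    ((measurable_matrix_entry p k).mul
      (continuous_star.measurable.comp (measurable_matrix_entry q i))).aestronglyMeasurable

theorem Imat_conjTranspose (N : ℕ) : (Imat N)ᴴ = -Imat N := by
  simp [Imat, Matrix.fromBlocks_conjTranspose, Matrix.fromBlocks_neg]

theorem Imat_transpose (N : ℕ) : (Imat N)ᵀ = -Imat N := by
  simp [Imat, Matrix.fromBlocks_transpose, Matrix.fromBlocks_neg]

theorem Imat_mul_self (N : ℕ) : Imat N * Imat N = -1 := by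
  simp [Imat, Matrix.fromBlocks_multiply, ← Matrix.fromBlocks_one, Matrix.fromBlocks_neg]

/-- The phases of a diagonal symplectic matrix acting nontrivially on the `j`-th coordinate pair. -/
def pairPhase {N : ℕ} (j : Fin N) : Fin N ⊕ Fin N → ℂ :=
  Sum.elim (fun x => if x = j then Complex.I else 1) (fun x => if x = j then -Complex.I else 1)

theorem diagonal_pairPhase_unitary {N : ℕ} (j : Fin N) :
    (diagonal (pairPhase j))ᴴ * diagonal (pairPhase j) = 1 := by
  rw [Matrix.diagonal_conjTranspose, Matrix.diagonal_mul_diagonal, ← Matrix.diagonal_one]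
  congr 1
  ext (x | x) <;> by_cases h : x = j <;> simp [pairPhase, h]

theorem diagonal_pairPhase_symplectic {N : ℕ} (j : Fin N) :
    (diagonal (pairPhase j))ᵀ * Imat N * diagonal (pairPhase j) = Imat N := by
  ext (x | x) (y | y) <;>
    simp only [Matrix.diagonal_transpose, Matrix.diagonal_mul, Matrix.mul_diagonal, Imat,
      Matrix.fromBlocks_apply₁₁, Matrix.fromBlocks_apply₁₂, Matrix.fromBlocks_apply₂₁,
      Matrix.fromBlocks_apply₂₂, Matrix.zero_apply, Matrix.neg_apply, mul_zero, zero_mul] <;>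
    by_cases hxy : x = y <;> by_cases hx : x = j <;> simp_all [pairPhase, Matrix.one_apply]

theorem pairPhase_mul_star_ne_one {N : ℕ} {p q : Fin N ⊕ Fin N} (hpq : p ≠ q) :
    ∃ j : Fin N, pairPhase j p * star (pairPhase j q) ≠ 1 := by
  refine ⟨p.elim id id, ?_⟩
  rcases p with x | x <;> rcases q with y | y <;> by_cases h : y = x <;>
    simp_all [pairPhase, Complex.ext_iff] <;> norm_num

/-- The symplectic matrix permuting the coordinate pairs by `σ`. -/
def pairPerm {N : ℕ} (σ : Equiv.Perm (Fin N)) : Matrix (Fin N ⊕ Fin N) (Fin N ⊕ Fin N) ℂ :=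
  Matrix.fromBlocks (σ.permMatrix ℂ) 0 0 (σ.permMatrix ℂ)

theorem permMatrix_transpose_mul_self {n : Type*} [Fintype n] [DecidableEq n]
    (σ : Equiv.Perm n) : (σ.permMatrix ℂ)ᵀ * σ.permMatrix ℂ = 1 := by
  rw [Matrix.transpose_permMatrix, ← Matrix.permMatrix_mul]
  simp

theorem pairPerm_unitary {N : ℕ} (σ : Equiv.Perm (Fin N)) :
    (pairPerm σ)ᴴ * pairPerm σ = 1 := by
  have h := permMatrix_transpose_mul_self σ
  rw [Matrix.transpose_permMatrix] at h
  simp [pairPerm, Matrix.fromBlocks_conjTranspose, Matrix.fromBlocks_multiply, h]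

theorem pairPerm_symplectic {N : ℕ} (σ : Equiv.Perm (Fin N)) :
    (pairPerm σ)ᵀ * Imat N * pairPerm σ = Imat N := by
  have h := permMatrix_transpose_mul_self σ
  rw [Matrix.transpose_permMatrix] at h
  simp [pairPerm, Imat, Matrix.fromBlocks_transpose, Matrix.fromBlocks_multiply, h]

section SecondMoment

variable {N : ℕ} (μ : Measure (Matrix (Fin N ⊕ Fin N) (Fin N ⊕ Fin N) ℂ))

theorem integral_entry_offdiag
    (hinv : ∀ S : Matrix (Fin N ⊕ Fin N) (Fin N ⊕ Fin N) ℂ,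
      Sᴴ * S = 1 → Sᵀ * Imat N * S = Imat N → μ.map (fun V => S * V) = μ)
    {p q : Fin N ⊕ Fin N} (hpq : p ≠ q) (i k : Fin N ⊕ Fin N) :
    ∫ V, V p k * star (V q i) ∂μ = 0 := by
  obtain ⟨j, hj⟩ := pairPhase_mul_star_ne_one hpq
  have h := integral_comp_mul_left μ (hinv _ (diagonal_pairPhase_unitary j)
    (diagonal_pairPhase_symplectic j)) p q i k
  have h2 : ∀ V : Matrix (Fin N ⊕ Fin N) (Fin N ⊕ Fin N) ℂ,
      (diagonal (pairPhase j) * V) p k * star ((diagonal (pairPhase j) * V) q i) =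
        pairPhase j p * star (pairPhase j q) * (V p k * star (V q i)) := by
    intro V
    simp only [Matrix.diagonal_mul, star_mul']
    ring
  simp only [h2, integral_const_mul] at h
  by_contra hne
  exact hj (mul_right_cancel₀ hne (by rw [← h, one_mul]))

theorem integral_entry_diag_eq
    (hinv : ∀ S : Matrix (Fin N ⊕ Fin N) (Fin N ⊕ Fin N) ℂ,
      Sᴴ * S = 1 → Sᵀ * Imat N * S = Imat N → μ.map (fun V => S * V) = μ)
    (p q i k : Fin N ⊕ Fin N) :
    ∫ V, V p k * star (V p i) ∂μ = ∫ V, V q k * star (V q i) ∂μ := by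
  have hswap : ∀ x : Fin N, ∫ V, V (.inl x) k * star (V (.inl x) i) ∂μ =
      ∫ V, V (.inr x) k * star (V (.inr x) i) ∂μ := by
    intro x
    have hV : ∀ (V : Matrix (Fin N ⊕ Fin N) (Fin N ⊕ Fin N) ℂ) l,
        (Imat N * V) (.inl x) l = - V (.inr x) l := by
      intro V l
      simp [Imat, Matrix.mul_apply, Matrix.one_apply]
    rw [integral_comp_mul_left μ (hinv (Imat N)
      (by rw [Imat_conjTranspose, neg_mul, Imat_mul_self, neg_neg])
      (by rw [Imat_transpose, neg_mul, Imat_mul_self, neg_neg, one_mul]))]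
    simp only [hV, star_neg, neg_mul_neg]
  have hperm : ∀ x y : Fin N, ∫ V, V (.inl x) k * star (V (.inl x) i) ∂μ =
      ∫ V, V (.inl y) k * star (V (.inl y) i) ∂μ := by
    intro x y
    have hV : ∀ (V : Matrix (Fin N ⊕ Fin N) (Fin N ⊕ Fin N) ℂ) l,
        (pairPerm (Equiv.swap x y) * V) (.inl x) l = V (.inl y) l := by
      intro V l
      simp [pairPerm, Matrix.mul_apply, Equiv.Perm.permMatrix, PEquiv.toMatrix_apply]
    rw [integral_comp_mul_left μ (hinv _ (pairPerm_unitary (Equiv.swap x y))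
      (pairPerm_symplectic _))]
    simp only [hV]
  rcases p with x | x <;> rcases q with y | y
  · exact hperm x y
  · rw [← hswap y]; exact hperm x y
  · rw [← hswap x]; exact hperm x y
  · rw [← hswap x, ← hswap y]; exact hperm x y

/-- Second moments of the matrix entries under Haar measure on the compact symplectic group. -/
theorem integral_entry_mul_star_entry [IsProbabilityMeasure μ]
    (hmem : ∀ᵐ V ∂μ, Vᴴ * V = 1)
    (hinv : ∀ S : Matrix (Fin N ⊕ Fin N) (Fin N ⊕ Fin N) ℂ,
      Sᴴ * S = 1 → Sᵀ * Imat N * S = Imat N → μ.map (fun V => S * V) = μ)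
    (p q i k : Fin N ⊕ Fin N) :
    ∫ V, V p k * star (V q i) ∂μ =
      (1 : Matrix _ _ ℂ) p q * (1 : Matrix _ _ ℂ) i k / (2 * N) := by
  by_cases hpq : p = q
  · subst hpq
    have hN : (N : ℂ) ≠ 0 := by
      rcases p with x | x <;> exact Nat.cast_ne_zero.2 (by have := x.2; omega)
    have hsum : ∑ r, ∫ V, V r k * star (V r i) ∂μ = (1 : Matrix _ _ ℂ) i k := by
      rw [← integral_finsetSum _ fun r _ => integrable_entry_mul_star_entry μ hmem r r i k]
      have : ∀ᵐ V ∂μ, ∑ r, V r k * star (V r i) = (1 : Matrix _ _ ℂ) i k := by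
        filter_upwards [hmem] with V hV
        rw [← hV, Matrix.mul_apply]
        exact Finset.sum_congr rfl fun r _ => by rw [Matrix.conjTranspose_apply, mul_comm]
      rw [integral_congr_ae this]
      simp
    rw [Finset.sum_congr rfl fun r _ => integral_entry_diag_eq μ hinv r p i k] at hsum
    simp only [Finset.sum_const, Finset.card_univ, Fintype.card_sum, Fintype.card_fin,
      nsmul_eq_mul, Nat.cast_add] at hsum
    rw [← hsum, Matrix.one_apply_eq]
    field_simp
    ring
  · rw [integral_entry_offdiag μ hinv hpq, Matrix.one_apply_ne hpq, zero_mul, zero_div]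

end SecondMoment

theorem conj_entry_mul_star_entry {n : Type*} [Fintype n] (a V W : Matrix n n ℂ)
    (i j k l : n) :
    (Vᴴ * a * W) i j * star ((Vᴴ * a * W) k l) =
      ∑ x : (n × n) × (n × n), a x.1.1 x.1.2 * star (a x.2.1 x.2.2) *
        ((V x.2.1 k * star (V x.1.1 i)) * (W x.1.2 j * star (W x.2.2 l))) := by
  have h : ∀ i j, (Vᴴ * a * W) i j = ∑ x : n × n, star (V x.1 i) * a x.1 x.2 * W x.2 j := by
    intro i j
    rw [Fintype.sum_prod_type_right]
    simp [Matrix.mul_apply, Finset.sum_mul]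
  rw [h, h, star_sum, Finset.sum_mul_sum, ← Finset.sum_product', Finset.univ_product_univ]
  refine Finset.sum_congr rfl fun x _ => ?_
  simp only [star_mul', star_star]
  ring

section ProductMoment

variable {N : ℕ} (a : Matrix (Fin N ⊕ Fin N) (Fin N ⊕ Fin N) ℂ)
  (μ ν : Measure (Matrix (Fin N ⊕ Fin N) (Fin N ⊕ Fin N) ℂ))
  [IsProbabilityMeasure μ] [IsProbabilityMeasure ν]

theorem integrable_conj_entry_mul_star_entry
    (hmemμ : ∀ᵐ V ∂μ, Vᴴ * V = 1) (hmemν : ∀ᵐ W ∂ν, Wᴴ * W = 1)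
    (i j k l : Fin N ⊕ Fin N) :
    Integrable (fun p : Matrix (Fin N ⊕ Fin N) (Fin N ⊕ Fin N) ℂ × _ =>
      (p.1ᴴ * a * p.2) i j * star ((p.1ᴴ * a * p.2) k l)) (μ.prod ν) := by
  simp only [conj_entry_mul_star_entry]
  exact integrable_finsetSum _ fun x _ =>
    ((integrable_entry_mul_star_entry μ hmemμ _ _ _ _).mul_prod
      (integrable_entry_mul_star_entry ν hmemν _ _ _ _)).const_mul _

theorem integral_conj_entry_mul_star_entry
    (hmemμ : ∀ᵐ V ∂μ, Vᴴ * V = 1)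
    (hinvμ : ∀ S : Matrix (Fin N ⊕ Fin N) (Fin N ⊕ Fin N) ℂ,
      Sᴴ * S = 1 → Sᵀ * Imat N * S = Imat N → μ.map (fun V => S * V) = μ)
    (hmemν : ∀ᵐ W ∂ν, Wᴴ * W = 1)
    (hinvν : ∀ S : Matrix (Fin N ⊕ Fin N) (Fin N ⊕ Fin N) ℂ,
      Sᴴ * S = 1 → Sᵀ * Imat N * S = Imat N → ν.map (fun W => S * W) = ν)
    (i j k l : Fin N ⊕ Fin N) :
    ∫ p, (p.1ᴴ * a * p.2) i j * star ((p.1ᴴ * a * p.2) k l) ∂(μ.prod ν) =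
      (1 : Matrix _ _ ℂ) i k * (1 : Matrix _ _ ℂ) j l * ((a * aᴴ).trace / (4 * (N : ℂ) ^ 2)) := by
  simp only [conj_entry_mul_star_entry]
  rw [integral_finsetSum _ fun x _ =>
    ((integrable_entry_mul_star_entry μ hmemμ _ _ _ _).mul_prod
      (integrable_entry_mul_star_entry ν hmemν _ _ _ _)).const_mul _]
  have hx : ∀ x : ((Fin N ⊕ Fin N) × (Fin N ⊕ Fin N)) × ((Fin N ⊕ Fin N) × (Fin N ⊕ Fin N)),
      ∫ p : Matrix (Fin N ⊕ Fin N) (Fin N ⊕ Fin N) ℂ × Matrix (Fin N ⊕ Fin N) (Fin N ⊕ Fin N) ℂ,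
        a x.1.1 x.1.2 * star (a x.2.1 x.2.2) *
        ((p.1 x.2.1 k * star (p.1 x.1.1 i)) * (p.2 x.1.2 j * star (p.2 x.2.2 l))) ∂(μ.prod ν) =
      a x.1.1 x.1.2 * star (a x.2.1 x.2.2) *
        (1 : Matrix _ _ ℂ) x.2.1 x.1.1 * (1 : Matrix _ _ ℂ) x.1.2 x.2.2 *
        ((1 : Matrix _ _ ℂ) i k * (1 : Matrix _ _ ℂ) j l / (4 * (N : ℂ) ^ 2)) := by
    intro x
    rw [integral_const_mul,
      integral_prod_mul (fun V : Matrix (Fin N ⊕ Fin N) (Fin N ⊕ Fin N) ℂ =>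
        V x.2.1 k * star (V x.1.1 i)) (fun W : Matrix (Fin N ⊕ Fin N) (Fin N ⊕ Fin N) ℂ =>
        W x.1.2 j * star (W x.2.2 l)),
      integral_entry_mul_star_entry μ hmemμ hinvμ, integral_entry_mul_star_entry ν hmemν hinvν,
      show (1 : Matrix (Fin N ⊕ Fin N) (Fin N ⊕ Fin N) ℂ) l j =
        (1 : Matrix (Fin N ⊕ Fin N) (Fin N ⊕ Fin N) ℂ) j l by
          simp only [Matrix.one_apply, eq_comm]]
    ring
  rw [Finset.sum_congr rfl fun x _ => hx x, ← Finset.sum_mul]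
  have htr : ∑ x : ((Fin N ⊕ Fin N) × (Fin N ⊕ Fin N)) × ((Fin N ⊕ Fin N) × (Fin N ⊕ Fin N)),
      a x.1.1 x.1.2 * star (a x.2.1 x.2.2) *
        (1 : Matrix _ _ ℂ) x.2.1 x.1.1 * (1 : Matrix _ _ ℂ) x.1.2 x.2.2 = (a * aᴴ).trace := by
    simp only [Fintype.sum_prod_type, Matrix.one_apply, mul_ite, mul_one, mul_zero,
      Finset.sum_ite_eq, Finset.sum_ite_eq', Finset.mem_univ, if_true, Matrix.trace,
      Matrix.diag_apply, Matrix.mul_apply, Matrix.conjTranspose_apply]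
  rw [htr]
  ring

end ProductMoment

theorem trace_mul_mul_mul {n : Type*} [Fintype n] (c g d h : Matrix n n ℂ) :
    (c * g * d * h).trace =
      ∑ x : (n × n) × (n × n), g x.1.2 x.2.1 * h x.2.2 x.1.1 *
        (c x.1.1 x.1.2 * d x.2.1 x.2.2) := by
  have : (c * g * d * h).trace = ∑ i, ∑ l, ∑ k, ∑ j, c i j * g j k * d k l * h l i := by
    simp only [Matrix.trace, Matrix.diag_apply, Matrix.mul_apply, Finset.sum_mul]
  rw [this]
  simp only [Fintype.sum_prod_type]
  refine Finset.sum_congr rfl fun i _ => ?_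
  rw [Finset.sum_comm, Finset.sum_congr rfl fun k _ => Finset.sum_comm, Finset.sum_comm]
  refine Finset.sum_congr rfl fun j _ => Finset.sum_congr rfl fun k _ =>
    Finset.sum_congr rfl fun l _ => by ring

/-- A random matrix whose entries are uncorrelated with common variance `t`. -/
structure HasWhiteEntries {Ω n : Type*} [DecidableEq n] [MeasurableSpace Ω]
    (P : Measure Ω) (c : Ω → Matrix n n ℂ) (t : ℂ) : Prop where
  integrable : ∀ i j k l, Integrable (fun ω => c ω i j * star (c ω k l)) P
  integral_eq : ∀ i j k l, ∫ ω, c ω i j * star (c ω k l) ∂P =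
    (1 : Matrix n n ℂ) i k * (1 : Matrix n n ℂ) j l * t

namespace HasWhiteEntries

variable {Ω n : Type*} [Fintype n] [DecidableEq n] [MeasurableSpace Ω]
  {P : Measure Ω} {c : Ω → Matrix n n ℂ} {t : ℂ}

theorem integrable_trace_map (hc : HasWhiteEntries P c t) (g h : Matrix n n ℂ) :
    Integrable (fun ω => (c ω * g * (c ω)ᴴᵀ * h).trace) P := by
  simp only [trace_mul_mul_mul, Matrix.transpose_apply, Matrix.conjTranspose_apply]
  exact integrable_finsetSum _ fun x _ => (hc.integrable _ _ _ _).const_mul _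

theorem integral_trace_map (hc : HasWhiteEntries P c t) (g h : Matrix n n ℂ) :
    ∫ ω, (c ω * g * (c ω)ᴴᵀ * h).trace ∂P = (g * hᵀ).trace * t := by
  simp only [trace_mul_mul_mul, Matrix.transpose_apply, Matrix.conjTranspose_apply]
  rw [integral_finsetSum _ fun x _ => (hc.integrable _ _ _ _).const_mul _]
  simp only [integral_const_mul, hc.integral_eq]
  simp only [← mul_assoc]
  rw [← Finset.sum_mul]
  congr 1
  simp only [Fintype.sum_prod_type, Matrix.one_apply, mul_ite, mul_one, mul_zero,
    Finset.sum_ite_eq, Finset.mem_univ, if_true, Matrix.trace, Matrix.diag_apply,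
    Matrix.mul_apply, Matrix.transpose_apply]
  exact Finset.sum_comm

theorem integrable_trace_conjTranspose (hc : HasWhiteEntries P c t) (g h : Matrix n n ℂ) :
    Integrable (fun ω => (c ω * g * (c ω)ᴴ * h).trace) P := by
  simp only [trace_mul_mul_mul, Matrix.conjTranspose_apply]
  exact integrable_finsetSum _ fun x _ => (hc.integrable _ _ _ _).const_mul _

theorem integral_trace_conjTranspose (hc : HasWhiteEntries P c t) (g h : Matrix n n ℂ) :
    ∫ ω, (c ω * g * (c ω)ᴴ * h).trace ∂P = g.trace * h.trace * t := by
  simp only [trace_mul_mul_mul, Matrix.conjTranspose_apply]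
  rw [integral_finsetSum _ fun x _ => (hc.integrable _ _ _ _).const_mul _]
  simp only [integral_const_mul, hc.integral_eq]
  simp only [← mul_assoc]
  rw [← Finset.sum_mul]
  congr 1
  simp only [Fintype.sum_prod_type, Matrix.one_apply, mul_ite, mul_one, mul_zero,
    Finset.sum_ite_eq, Finset.mem_univ, if_true, Matrix.trace, Matrix.diag_apply,
    Finset.sum_mul_sum, Finset.sum_ite_irrel, Finset.sum_const_zero]
  exact Finset.sum_comm

end HasWhiteEntries

/-- Conjugation by `Imat` fixes unitary symplectic matrices up to sign and complex conjugation. -/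
theorem Imat_mul_map_mul_Imat {N : ℕ} {V : Matrix (Fin N ⊕ Fin N) (Fin N ⊕ Fin N) ℂ}
    (h1 : Vᴴ * V = 1) (h2 : Vᵀ * Imat N * V = Imat N) : Imat N * Vᴴᵀ * Imat N = -V := by
  have h3 : V * Vᴴ = 1 := mul_eq_one_comm.1 h1
  have h4 : Vᴴᵀ * Vᵀ = 1 := by rw [← Matrix.transpose_mul, h3, Matrix.transpose_one]
  have h5 : Vᴴᵀ * Imat N = Imat N * V := by
    calc Vᴴᵀ * Imat N = Vᴴᵀ * Vᵀ * Imat N * V := by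
          conv_lhs => rw [← h2]
          simp only [mul_assoc]
      _ = Imat N * V := by rw [h4, one_mul]
  rw [mul_assoc, h5, ← mul_assoc, Imat_mul_self, neg_mul, one_mul]

theorem Imat_mul_transpose_mul_Imat {N : ℕ} {V : Matrix (Fin N ⊕ Fin N) (Fin N ⊕ Fin N) ℂ}
    (h1 : Vᴴ * V = 1) (h2 : Vᵀ * Imat N * V = Imat N) : Imat N * Vᵀ * Imat N = -Vᴴ := by
  have h := congrArg Matrix.conjTranspose (Imat_mul_map_mul_Imat h1 h2)
  have h3 : Vᴴᵀᴴ = Vᵀ := by ext; simp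
  simpa [Matrix.conjTranspose_mul, Imat_conjTranspose, h3, mul_assoc] using h

theorem Imat_mul_map_mul_Imat_conj {N : ℕ}
    {a V W : Matrix (Fin N ⊕ Fin N) (Fin N ⊕ Fin N) ℂ} (ha : Imat N * aᴴᵀ * Imat N = a)
    (hV1 : Vᴴ * V = 1) (hV2 : Vᵀ * Imat N * V = Imat N)
    (hW1 : Wᴴ * W = 1) (hW2 : Wᵀ * Imat N * W = Imat N) :
    Imat N * (Vᴴ * a * W)ᴴᵀ * Imat N = Vᴴ * a * W := by
  have hI := Imat_mul_self N
  have key : Imat N * (Vᴴ * a * W)ᴴᵀ * Imat N =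
      (Imat N * Vᵀ * Imat N) * (Imat N * aᴴᵀ * Imat N) * (Imat N * Wᴴᵀ * Imat N) := by
    have : ∀ X : Matrix (Fin N ⊕ Fin N) (Fin N ⊕ Fin N) ℂ, Imat N * (Imat N * X) = -X := by
      intro X
      rw [← mul_assoc, hI, neg_mul, one_mul]
    simp [Matrix.conjTranspose_mul, Matrix.transpose_mul, mul_assoc, this]
  rw [key, ha, Imat_mul_map_mul_Imat hW1 hW2, Imat_mul_transpose_mul_Imat hV1 hV2]
  simp

theorem trace_fromBlocks_diag {n : Type*} [Fintype n] (p q r s : Matrix n n ℂ) :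
    (fromBlocks p q r s).trace = p.trace + s.trace := by
  simp [Matrix.trace]

theorem trace_block_mul {n : Type*} [Fintype n] (c e f : Matrix n n ℂ) :
    (fromBlocks 0 c cᴴ 0 * fromBlocks e f f e * fromBlocks 0 c cᴴ 0 *
        fromBlocks e f f e).trace =
      2 * (c * e * cᴴ * e).trace + (c * f * c * f).trace + (cᴴ * f * cᴴ * f).trace := by
  have h : (cᴴ * e * c * e).trace = (c * e * cᴴ * e).trace := by
    rw [mul_assoc, Matrix.trace_mul_comm, ← mul_assoc]
  simp only [Matrix.fromBlocks_multiply, trace_fromBlocks_diag, zero_mul, zero_add, mul_zero,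
    add_zero, Matrix.trace_add, h]
  ring

/-- The two holomorphic quartic traces, rewritten so that one factor is complex conjugated. -/
theorem trace_mul_mul_mul_of_Imat_conj {N : ℕ}
    {c f : Matrix (Fin N ⊕ Fin N) (Fin N ⊕ Fin N) ℂ} (hc : Imat N * cᴴᵀ * Imat N = c) :
    (c * f * c * f).trace = (c * (f * Imat N) * cᴴᵀ * (Imat N * f)).trace := by
  have h : c * f * c * f = c * f * (Imat N * cᴴᵀ * Imat N) * f := by rw [hc]
  rw [h]
  simp only [mul_assoc]

theorem trace_conjTranspose_mul_of_Imat_conj {N : ℕ}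
    {c f : Matrix (Fin N ⊕ Fin N) (Fin N ⊕ Fin N) ℂ} (hc : Imat N * cᴴᵀ * Imat N = c)
    (hf : fᵀ = f) :
    (cᴴ * f * cᴴ * f).trace = (c * (Imat N * f) * cᴴᵀ * (f * Imat N)).trace := by
  have hc' : Imat N * cᵀ * Imat N = cᴴ := by
    have h := congrArg Matrix.transpose hc
    have h2 : Imat N * cᴴ * Imat N = cᵀ := by
      simpa [Matrix.transpose_mul, Imat_transpose, mul_assoc] using h
    rw [← h2, ← mul_assoc, ← mul_assoc, Imat_mul_self, mul_assoc, Imat_mul_self]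
    simp
  rw [← Matrix.trace_transpose (c * (Imat N * f) * cᴴᵀ * (f * Imat N))]
  have h : cᴴ * f * cᴴ * f = cᴴ * f * (Imat N * cᵀ * Imat N) * f := by rw [hc']
  rw [h, ← mul_assoc, ← mul_assoc, mul_assoc, Matrix.trace_mul_comm]
  simp only [Matrix.transpose_mul, Imat_transpose, hf, Matrix.transpose_transpose, neg_mul,
    mul_neg, neg_neg, mul_assoc]

theorem trace_conj_blocks {N : ℕ}
    {a e f V W : Matrix (Fin N ⊕ Fin N) (Fin N ⊕ Fin N) ℂ} (hf : fᵀ = f)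
    (hc : Imat N * (Vᴴ * a * W)ᴴᵀ * Imat N = Vᴴ * a * W) :
    ((fromBlocks V 0 0 W)ᴴ * fromBlocks 0 a aᴴ 0 * fromBlocks V 0 0 W * fromBlocks e f f e *
        (fromBlocks V 0 0 W)ᴴ * fromBlocks 0 a aᴴ 0 * fromBlocks V 0 0 W *
        fromBlocks e f f e).trace =
      2 * ((Vᴴ * a * W) * e * (Vᴴ * a * W)ᴴ * e).trace +
        ((Vᴴ * a * W) * (f * Imat N) * (Vᴴ * a * W)ᴴᵀ * (Imat N * f)).trace +
        ((Vᴴ * a * W) * (Imat N * f) * (Vᴴ * a * W)ᴴᵀ * (f * Imat N)).trace := by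
  have hblock : (fromBlocks V 0 0 W)ᴴ * fromBlocks 0 a aᴴ 0 * fromBlocks V 0 0 W =
      fromBlocks 0 (Vᴴ * a * W) (Vᴴ * a * W)ᴴ 0 := by
    simp [Matrix.fromBlocks_conjTranspose, Matrix.fromBlocks_multiply,
      Matrix.conjTranspose_mul, mul_assoc]
  rw [← trace_mul_mul_mul_of_Imat_conj hc, ← trace_conjTranspose_mul_of_Imat_conj hc hf,
    ← trace_block_mul, ← hblock]
  simp only [mul_assoc]

/-- Let `a` be a `2N×2N` matrix with `I·ā·I = a`, `B = (e, f; f, e)` self-adjoint and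
symmetric, and `A = (0, a; a*, 0)`. Averaging `Tr(U*AUBU*AUB)` over `U = diag(V, W)` with
`V`, `W` independently Haar-distributed on the compact symplectic group `SP(2N)` gives
`Tr(A²)·(Tr(e)² + Tr(I*fIf)) / (4N²)`. -/
theorem blockdiag_symplectic_fourth_moment (N : ℕ) (hN : 0 < N)
    (a e f : Matrix (Fin N ⊕ Fin N) (Fin N ⊕ Fin N) ℂ)
    (ha : Imat N * aᴴᵀ * Imat N = a)
    (hB1 : (Matrix.fromBlocks e f f e)ᴴ = Matrix.fromBlocks e f f e)
    (hB2 : (Matrix.fromBlocks e f f e)ᵀ = Matrix.fromBlocks e f f e)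
    (μ ν : Measure (Matrix (Fin N ⊕ Fin N) (Fin N ⊕ Fin N) ℂ))
    [IsProbabilityMeasure μ] [IsProbabilityMeasure ν]
    (hmemμ : ∀ᵐ V ∂μ, Vᴴ * V = 1 ∧ Vᵀ * Imat N * V = Imat N)
    (hinvμ : ∀ S : Matrix (Fin N ⊕ Fin N) (Fin N ⊕ Fin N) ℂ,
      Sᴴ * S = 1 → Sᵀ * Imat N * S = Imat N → μ.map (fun V => S * V) = μ)
    (hmemν : ∀ᵐ W ∂ν, Wᴴ * W = 1 ∧ Wᵀ * Imat N * W = Imat N)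
    (hinvν : ∀ S : Matrix (Fin N ⊕ Fin N) (Fin N ⊕ Fin N) ℂ,
      Sᴴ * S = 1 → Sᵀ * Imat N * S = Imat N → ν.map (fun W => S * W) = ν) :
    ∫ p, ((Matrix.fromBlocks p.1 0 0 p.2)ᴴ * Matrix.fromBlocks 0 a aᴴ 0 *
        Matrix.fromBlocks p.1 0 0 p.2 * Matrix.fromBlocks e f f e *
        (Matrix.fromBlocks p.1 0 0 p.2)ᴴ * Matrix.fromBlocks 0 a aᴴ 0 *
        Matrix.fromBlocks p.1 0 0 p.2 * Matrix.fromBlocks e f f e).trace ∂(μ.prod ν) =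
      (Matrix.fromBlocks 0 a aᴴ (0 : Matrix (Fin N ⊕ Fin N) (Fin N ⊕ Fin N) ℂ) *
          Matrix.fromBlocks 0 a aᴴ 0).trace *
        (e.trace ^ 2 + ((Imat N)ᴴ * f * Imat N * f).trace) / (4 * (N : ℂ) ^ 2) := by
  have hf : fᵀ = f :=
    (Matrix.fromBlocks_inj.1 ((Matrix.fromBlocks_transpose _ _ _ _).symm.trans hB2)).2.1
  have hmemμ1 : ∀ᵐ V ∂μ, Vᴴ * V = 1 := hmemμ.mono fun _ h => h.1
  have hmemν1 : ∀ᵐ W ∂ν, Wᴴ * W = 1 := hmemν.mono fun _ h => h.1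
  have hc : HasWhiteEntries (μ.prod ν) (fun p => p.1ᴴ * a * p.2)
      ((a * aᴴ).trace / (4 * (N : ℂ) ^ 2)) :=
    ⟨integrable_conj_entry_mul_star_entry a μ ν hmemμ1 hmemν1,
      integral_conj_entry_mul_star_entry a μ ν hmemμ1 hinvμ hmemν1 hinvν⟩
  have hae : ∀ᵐ p ∂(μ.prod ν), Imat N * (p.1ᴴ * a * p.2)ᴴᵀ * Imat N = p.1ᴴ * a * p.2 := by
    filter_upwards [Measure.quasiMeasurePreserving_fst.ae hmemμ,
      Measure.quasiMeasurePreserving_snd.ae hmemν] with p hV hW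
    exact Imat_mul_map_mul_Imat_conj ha hV.1 hV.2 hW.1 hW.2
  rw [integral_congr_ae (hae.mono fun p hp => trace_conj_blocks hf hp), integral_add, integral_add, integral_const_mul,
    hc.integral_trace_conjTranspose, hc.integral_trace_map, hc.integral_trace_map]
  rotate_left
  · exact (hc.integrable_trace_conjTranspose e e).const_mul 2
  · exact hc.integrable_trace_map _ _
  · exact ((hc.integrable_trace_conjTranspose e e).const_mul 2).add (hc.integrable_trace_map _ _)
  · exact hc.integrable_trace_map _ _
  have hT1 : (f * Imat N * (Imat N * f)ᵀ).trace = ((Imat N)ᴴ * f * Imat N * f).trace := by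
    rw [Matrix.transpose_mul, hf, Imat_transpose, Imat_conjTranspose, Matrix.trace_mul_comm]
    simp [mul_assoc, Matrix.trace_mul_comm f]
  have hT2 : (Imat N * f * (f * Imat N)ᵀ).trace = ((Imat N)ᴴ * f * Imat N * f).trace := by
    rw [Matrix.transpose_mul, hf, Imat_transpose, Imat_conjTranspose]
    simp [mul_assoc]
  have hA : (Matrix.fromBlocks 0 a aᴴ (0 : Matrix (Fin N ⊕ Fin N) (Fin N ⊕ Fin N) ℂ) *
      Matrix.fromBlocks 0 a aᴴ 0).trace = 2 * (a * aᴴ).trace := by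
    simp [Matrix.fromBlocks_multiply, trace_fromBlocks_diag, Matrix.trace_mul_comm aᴴ a, two_mul]
  rw [hT1, hT2, hA]
  ring
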